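/- arXiv:2105.05524 — 8 statements merged into one kernel-verified Lean document; each statement's English description precedes it below -/
import Mathlib

section
/- Let X be a compact metric space and f : X → X a continuous map. For every x ∈ X and ε > 0, the set U_{x,ε} := {y ∈ X | there exists an ε-pseudo-orbit from x to y} is open, nonempty, and satisfies closure(f(U_{x,ε})) ⊆ U_{x,ε}; in particular U_{x,ε} is a trapping region, so A_{x,ε} := ⋂_{n≥0} f^n(U_{x,ε}) is an attracting set. -/
open Set Filter Topology

section ChainRecurrence

variable {X : Type*} [MetricSpace X]

/-- There exists an `ε`-pseudo-orbit from `x` to `y`: a finite sequence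
`x_0 = x, …, x_n = y` with `n ≥ 1` and `dist (f x_i) x_{i+1} < ε` for all `i < n`. -/
def PseudoOrbit (f : X → X) (ε : ℝ) (x y : X) : Prop :=
  ∃ n : ℕ, 1 ≤ n ∧ ∃ u : ℕ → X, u 0 = x ∧ u n = y ∧
    ∀ i, i < n → dist (f (u i)) (u (i + 1)) < ε

/-- `x ≻ y` : for every `ε > 0` there is an `ε`-pseudo-orbit from `x` to `y`. -/
def ChainSucc (f : X → X) (x y : X) : Prop :=
  ∀ ε : ℝ, 0 < ε → PseudoOrbit f ε x y

/-- The chain recurrent set `R(f) = {x | x ≻ x}`. -/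
def chainRecurrentSet (f : X → X) : Set X := {x | ChainSucc f x x}

/-- A trapping region: a nonempty open set `U` with `closure (f '' U) ⊆ U`. -/
def IsTrappingRegion (f : X → X) (U : Set X) : Prop :=
  U.Nonempty ∧ IsOpen U ∧ closure (f '' U) ⊆ U

/-- The attracting set associated to `U`, namely `⋂ n, f^n(U)`. -/
def attractingSetOf (f : X → X) (U : Set X) : Set X := ⋂ n : ℕ, f^[n] '' U

/-- `A` is an attracting set if it is the attracting set of some trapping region. -/
def IsAttractingSet (f : X → X) (A : Set X) : Prop :=
  ∃ U : Set X, IsTrappingRegion f U ∧ A = attractingSetOf f U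

/-- The basin `B(A) = ⋃ n, f^{-n}(U)` of the attracting set associated to `U`. -/
def basinOf (f : X → X) (U : Set X) : Set X := ⋃ n : ℕ, f^[n] ⁻¹' U

/-- `U_{x,ε}` : the set of endpoints of `ε`-pseudo-orbits starting at `x`. -/
def pseudoReach (f : X → X) (ε : ℝ) (x : X) : Set X := {y | PseudoOrbit f ε x y}

/-- `A_{x,ε} := ⋂ n, f^n (U_{x,ε})`. -/
def Aeps (f : X → X) (ε : ℝ) (x : X) : Set X := attractingSetOf f (pseudoReach f ε x)

/-- The quasi-attractor `A_x := ⋂_{ε > 0} A_{x,ε}`. -/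
def quasiAttractorOf (f : X → X) (x : X) : Set X := ⋂ (ε : ℝ) (_ : 0 < ε), Aeps f ε x

/-- The chain recurrence class `[x] = {y ∈ R(f) | x ≻ y ∧ y ≻ x}`. -/
def chainClass (f : X → X) (x : X) : Set X :=
  {y | y ∈ chainRecurrentSet f ∧ ChainSucc f x y ∧ ChainSucc f y x}

/-- A quasi-attractor: the intersection of a decreasing family of attracting sets. -/
def IsQuasiAttractor (f : X → X) (Q : Set X) : Prop :=
  ∃ A : ℕ → Set X, (∀ n, IsAttractingSet f (A n)) ∧ (∀ n, A (n + 1) ⊆ A n) ∧ Q = ⋂ n, A n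

/-- The ω-limit set of `z` : all limits of convergent subsequences of `(f^n z)ₙ`. -/
def limitSet (f : X → X) (z : X) : Set X :=
  {p | ∃ φ : ℕ → ℕ, StrictMono φ ∧ Tendsto (fun k => f^[φ k] z) atTop (𝓝 p)}

theorem pseudoReach_isOpen_aux (f : X → X) (ε : ℝ) (x : X) :
    pseudoReach f ε x = ⋃ p ∈ {p : X | p = x ∨ p ∈ pseudoReach f ε x}, Metric.ball (f p) ε := by
  ext z
  simp only [mem_iUnion, mem_setOf_eq, exists_prop, Metric.mem_ball]
  constructor
  · rintro ⟨n, hn, u, h0, hu, h⟩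
    obtain ⟨m, rfl⟩ : ∃ m, n = m + 1 := ⟨n - 1, by omega⟩
    refine ⟨u m, ?_, ?_⟩
    · rcases Nat.eq_zero_or_pos m with hm | hm
      · left; rw [hm, h0]
      · right
        exact ⟨m, hm, u, h0, rfl, fun i hi => h i (by omega)⟩
    · rw [← hu, dist_comm]
      exact h m (by omega)
  · rintro ⟨p, hp, hz⟩
    rw [dist_comm] at hz
    rcases hp with rfl | ⟨n, hn, u, h0, hu, h⟩
    · refine ⟨1, le_refl _, fun i => if i = 0 then p else z, by simp, by simp, ?_⟩
      intro i hi
      obtain rfl : i = 0 := by omega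
      simpa using hz
    · refine ⟨n + 1, by omega, fun i => if i ≤ n then u i else z, by simp [h0], by simp, ?_⟩
      intro i hi
      rcases Nat.lt_or_ge i n with hin | hin
      · have h1 : i ≤ n := by omega
        have h2 : i + 1 ≤ n := by omega
        simpa only [h1, h2, if_true] using h i hin
      · obtain rfl : i = n := by omega
        simpa [hu] using hz

/-- For every `x` and `ε > 0`, the set `U_{x,ε}` of endpoints of `ε`-pseudo-orbits starting
at `x` is open, nonempty and satisfies `closure (f '' U) ⊆ U`; in particular it is a
trapping region and `A_{x,ε} = ⋂ n, f^n(U_{x,ε})` is an attracting set. -/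
theorem pseudoReach_isTrappingRegion {X : Type*} [MetricSpace X] [CompactSpace X]
    (f : X → X) (hf : Continuous f) (x : X) (ε : ℝ) (hε : 0 < ε) :
    IsOpen (pseudoReach f ε x) ∧ (pseudoReach f ε x).Nonempty ∧
    closure (f '' pseudoReach f ε x) ⊆ pseudoReach f ε x ∧
    IsTrappingRegion f (pseudoReach f ε x) ∧ IsAttractingSet f (Aeps f ε x) := by
  have key := pseudoReach_isOpen_aux f ε x
  have hopen : IsOpen (pseudoReach f ε x) := by
    rw [key]
    exact isOpen_biUnion fun p _ => Metric.isOpen_ball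
  have hne : (pseudoReach f ε x).Nonempty := by
    refine ⟨f x, ?_⟩
    rw [key]
    exact mem_biUnion (Or.inl rfl) (Metric.mem_ball_self hε)
  have hcl : closure (f '' pseudoReach f ε x) ⊆ pseudoReach f ε x := by
    intro z hz
    obtain ⟨w, ⟨p, hp, rfl⟩, hw⟩ := Metric.mem_closure_iff.1 hz ε hε
    rw [key]
    exact mem_biUnion (Or.inr hp) (Metric.mem_ball.2 hw)
  exact ⟨hopen, hne, hcl, ⟨hne, hopen, hcl⟩, _, ⟨hne, hopen, hcl⟩, rfl⟩

end ChainRecurrence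
end

section
/- Let X be a compact metric space and f : X → X a continuous map. The chain recurrent set satisfies R(f) = ⋂_U (A_U ∪ A_U*), where the intersection is taken over all trapping regions U of f, A_U := ⋂_{n≥0} f^n(U) is the associated attracting set, B(A_U) := ⋃_{n≥0} f^{-n}(U) is its basin, and A_U* := X \ B(A_U) is the associated repelling set. -/
open Set Filter Topology

section ChainRecurrence

variable {X : Type*} [MetricSpace X]

theorem po_iff {X : Type*} [MetricSpace X] (f : X → X) (ε : ℝ) (x z : X) :
    PseudoOrbit f ε x z ↔ ∃ y, (y = x ∨ PseudoOrbit f ε x y) ∧ dist (f y) z < ε := by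
  constructor
  · rintro ⟨n, hn, u, h0, h1, h⟩
    obtain ⟨m, rfl⟩ : ∃ m, n = m + 1 := ⟨n - 1, by omega⟩
    refine ⟨u m, ?_, by simpa [h1] using h m (by omega)⟩
    rcases Nat.eq_zero_or_pos m with rfl | hm
    · exact Or.inl h0
    · exact Or.inr ⟨m, hm, u, h0, rfl, fun i hi => h i (by omega)⟩
  · rintro ⟨y, rfl | ⟨n, hn, u, h0, h1, h⟩, hy⟩
    · refine ⟨1, le_rfl, fun i => if i = 0 then y else z, by simp, by simp, ?_⟩
      intro i hi
      obtain rfl : i = 0 := by omega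
      simpa using hy
    · refine ⟨n + 1, by omega, fun i => if i ≤ n then u i else z, by simpa using h0, by simp, ?_⟩
      intro i hi
      rcases Nat.lt_or_ge i n with h2 | h2
      · simpa [h2.le, Nat.succ_le_of_lt h2] using h i h2
      · obtain rfl : i = n := by omega
        simpa [h1] using hy

theorem po_prepend {X : Type*} [MetricSpace X] (f : X → X) (ε : ℝ) (hε : 0 < ε) (y z : X)
    (h : PseudoOrbit f ε (f y) z) : PseudoOrbit f ε y z := by
  obtain ⟨n, hn, u, h0, h1, h⟩ := h
  refine ⟨n + 1, by omega, fun i => Nat.casesOn i y u, rfl, h1, ?_⟩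
  intro i hi
  cases i with
  | zero => simpa [h0] using hε
  | succ j => exact h j (by omega)

theorem rec_mem {X : Type*} [MetricSpace X] [CompactSpace X] (f : X → X)
    (V : Set X) (hVo : IsOpen V) (K : Set X) (hK : IsClosed K) (hKV : K ⊆ V)
    (hfK : ∀ y ∈ V, f y ∈ K) (x : X) (hx : x ∈ chainRecurrentSet f) (hfx : f x ∈ V) : x ∈ V := by
  obtain ⟨δ, hδ, hd⟩ := hK.isCompact.exists_thickening_subset_open hVo hKV
  obtain ⟨η, hη, he⟩ := Metric.isOpen_iff.1 hVo _ hfx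
  obtain ⟨n, hn, u, h0, h1, h⟩ := hx (min δ η) (lt_min hδ hη)
  have key : ∀ i, i < n → u (i + 1) ∈ V := by
    intro i
    induction i with
    | zero =>
      intro hi
      apply he
      have := h 0 hi
      rw [h0] at this
      rw [Metric.mem_ball, dist_comm]
      exact this.trans_le (min_le_right _ _)
    | succ j ih =>
      intro hi
      apply hd
      rw [Metric.mem_thickening_iff]
      refine ⟨_, hfK _ (ih (by omega)), ?_⟩
      rw [dist_comm]
      exact (h (j + 1) hi).trans_le (min_le_left _ _)
  have := key (n - 1) (by omega)
  rwa [Nat.sub_add_cancel hn, h1] at this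

theorem rec_basin {X : Type*} [MetricSpace X] [CompactSpace X] (f : X → X) (hf : Continuous f)
    (U : Set X) (hU : IsTrappingRegion f U) (x : X) (hx : x ∈ chainRecurrentSet f)
    (k : ℕ) (hk : f^[k] x ∈ U) : x ∈ U := by
  induction k with
  | zero => exact hk
  | succ k ih =>
    apply ih
    refine rec_mem f (f^[k] ⁻¹' U) (hU.2.1.preimage (hf.iterate k))
      (f^[k] ⁻¹' (closure (f '' U))) (isClosed_closure.preimage (hf.iterate k))
      (preimage_mono hU.2.2) ?_ x hx hk
    intro y hy
    apply subset_closure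
    refine ⟨_, hy, ?_⟩
    exact (Function.iterate_succ_apply' f k y).symm.trans (Function.iterate_succ_apply f k y)

theorem rec_pre {X : Type*} [MetricSpace X] [CompactSpace X] (f : X → X) (hf : Continuous f)
    (x : X) (hx : x ∈ chainRecurrentSet f) : ∃ y ∈ chainRecurrentSet f, f y = x := by
  have H : ∀ n : ℕ, ∃ y, PseudoOrbit f (1 / ((n : ℝ) + 1)) x y ∧
      dist (f y) x < 1 / ((n : ℝ) + 1) := by
    intro n
    have h := hx _ (Nat.one_div_pos_of_nat (n := n) (α := ℝ))
    obtain ⟨y, rfl | hy, hd⟩ := (po_iff _ _ _ _).1 h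
    · exact ⟨y, h, hd⟩
    · exact ⟨y, hy, hd⟩
  choose v hv hd using H
  obtain ⟨y, φ, hφ, hy⟩ := CompactSpace.tendsto_subseq v
  have hlim : Tendsto (fun n => 1 / ((φ n : ℝ) + 1)) atTop (𝓝 0) :=
    tendsto_one_div_add_atTop_nhds_zero_nat.comp hφ.tendsto_atTop
  have hfy : f y = x := by
    have h1 : Tendsto (fun n => f (v (φ n))) atTop (𝓝 (f y)) := (hf.tendsto y).comp hy
    have h2 : Tendsto (fun n => f (v (φ n))) atTop (𝓝 x) := by
      rw [tendsto_iff_dist_tendsto_zero]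
      exact squeeze_zero (fun _ => dist_nonneg) (fun n => (hd (φ n)).le) hlim
    exact tendsto_nhds_unique h1 h2
  refine ⟨y, ?_, hfy⟩
  intro ε hε
  apply po_prepend f ε hε
  rw [hfy]
  have e1 := hlim.eventually (gt_mem_nhds (half_pos hε))
  have e2 := hy.eventually (Metric.ball_mem_nhds y (half_pos hε))
  obtain ⟨n, hn1, hn2⟩ := (e1.and e2).exists
  have hn2 : dist (v (φ n)) y < ε / 2 := hn2
  obtain ⟨w, hw, hwd⟩ := (po_iff _ _ _ _).1 (hv (φ n))
  refine (po_iff _ _ _ _).2 ⟨w, hw.imp id ?_, ?_⟩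
  · rintro ⟨m, hm, u, h0, h1, h⟩
    exact ⟨m, hm, u, h0, h1, fun i hi => (h i hi).trans (by linarith)⟩
  · have := dist_triangle (f w) (v (φ n)) y
    linarith

/-- `R(f) = ⋂_U (A_U ∪ A_U*)`, the intersection over all trapping regions `U` of the union of
the associated attracting set and the associated repelling set (complement of the basin). -/
theorem chainRecurrentSet_eq_iInter {X : Type*} [MetricSpace X] [CompactSpace X]
    (f : X → X) (hf : Continuous f) :
    chainRecurrentSet f =
      ⋂ U ∈ {U : Set X | IsTrappingRegion f U}, (attractingSetOf f U ∪ (basinOf f U)ᶜ) := by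
  ext x
  simp only [mem_iInter, mem_ofPred_eq]
  constructor
  · intro hx U hU
    by_cases hb : x ∈ basinOf f U
    · left
      obtain ⟨k, hk⟩ := mem_iUnion.1 hb
      have hk : f^[k] x ∈ U := hk
      refine mem_iInter.2 fun m => ?_
      have : ∃ y ∈ chainRecurrentSet f, f^[m] y = x := by
        clear hk hb
        induction m with
        | zero => exact ⟨x, hx, rfl⟩
        | succ m ih =>
          obtain ⟨y, hy, h⟩ := ih
          obtain ⟨z, hz, h'⟩ := rec_pre f hf y hy
          exact ⟨z, hz, by rw [Function.iterate_succ_apply, h', h]⟩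
      obtain ⟨y, hy, h⟩ := this
      refine ⟨y, rec_basin f hf U hU y hy (k + m) ?_, h⟩
      rwa [Function.iterate_add_apply, h]
    · exact Or.inr hb
  · intro h
    by_contra hx
    have hx' : ∃ ε : ℝ, 0 < ε ∧ ¬ PseudoOrbit f ε x x := by
      by_contra hc
      push Not at hc
      exact hx hc
    obtain ⟨ε, hε, hn⟩ := hx'
    have hfx : f x ∈ pseudoReach f ε x :=
      (po_iff _ _ _ _).2 ⟨x, Or.inl rfl, by simpa using hε⟩
    have hT : IsTrappingRegion f (pseudoReach f ε x) := by
      refine ⟨⟨_, hfx⟩, ?_, ?_⟩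
      · have : pseudoReach f ε x =
            ⋃ y ∈ {y | y = x ∨ PseudoOrbit f ε x y}, Metric.ball (f y) ε := by
          ext z
          simp only [pseudoReach, mem_ofPred_eq, mem_iUnion, Metric.mem_ball, exists_prop]
          rw [po_iff]
          simp only [dist_comm]
        rw [this]
        exact isOpen_biUnion fun _ _ => Metric.isOpen_ball
      · intro z hz
        obtain ⟨_, ⟨u, hu, rfl⟩, hd⟩ := Metric.mem_closure_iff.1 hz ε hε
        exact (po_iff _ _ _ _).2 ⟨u, Or.inr hu, by rwa [dist_comm]⟩
    rcases h _ hT with h | h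
    · obtain ⟨y, hy, rfl⟩ := mem_iInter.1 h 0
      exact hn hy
    · exact h (mem_iUnion.2 ⟨1, hfx⟩)

end ChainRecurrence
end

section
/- Let X be a compact metric space and f : X → X a continuous map. For all x, y in the chain recurrent set R(f), one has x ≻ y if and only if y ∈ A_x, where A_x := ⋂_{ε>0} ⋂_{n≥0} f^n(U_{x,ε}) and U_{x,ε} := {z ∈ X | there exists an ε-pseudo-orbit from x to z}. -/
open Set Filter Topology

section ChainRecurrence

variable {X : Type*} [MetricSpace X]

def LPO {X : Type*} [MetricSpace X] (f : X → X) (ε : ℝ) (n : ℕ) (x y : X) : Prop :=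
  ∃ u : ℕ → X, u 0 = x ∧ u n = y ∧ ∀ i, i < n → dist (f (u i)) (u (i + 1)) < ε

theorem LPO.concat {X : Type*} [MetricSpace X] {f : X → X} {ε : ℝ} {n m : ℕ} {x y z : X}
    (h1 : LPO f ε n x y) (h2 : LPO f ε m y z) : LPO f ε (n + m) x z := by
  obtain ⟨u, u0, un, hu⟩ := h1
  obtain ⟨v, v0, vm, hv⟩ := h2
  refine ⟨fun i => if i ≤ n then u i else v (i - n), by simp [u0], ?_, ?_⟩
  · by_cases hm : m = 0
    · subst hm
      simp [un, ← vm, v0]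
    · have : ¬ (n + m ≤ n) := by omega
      simp only [this, if_false]
      rw [Nat.add_sub_cancel_left, vm]
  · intro i hi
    rcases lt_trichotomy i n with h | h | h
    · have h1 : i ≤ n := by omega
      have h2 : i + 1 ≤ n := by omega
      simp only [h1, h2, if_true]
      exact hu i h
    · subst h
      have := hv 0 (by omega)
      simp only [le_refl, if_true, Nat.not_succ_le_self, if_false, Nat.add_sub_cancel_left, un]
      rw [v0] at this
      exact this
    · have h1 : ¬ i ≤ n := by omega
      have h2 : ¬ i + 1 ≤ n := by omega
      simp only [h1, h2, if_false]
      have := hv (i - n) (by omega)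
      rwa [show i - n + 1 = i + 1 - n by omega] at this

def LongSucc {X : Type*} [MetricSpace X] (f : X → X) (x y : X) : Prop :=
  ∀ ε : ℝ, 0 < ε → ∀ N : ℕ, ∃ n, N ≤ n ∧ 1 ≤ n ∧ LPO f ε n x y

theorem longSucc_of {X : Type*} [MetricSpace X] {f : X → X} {x y : X}
    (hx : ChainSucc f x x) (hxy : ChainSucc f x y) : LongSucc f x y := by
  intro ε hε N
  induction N with
  | zero =>
    obtain ⟨n, hn, h⟩ := hxy ε hε
    exact ⟨n, by omega, hn, h⟩
  | succ N ih =>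
    obtain ⟨n, hn, hn1, h⟩ := ih
    obtain ⟨m, hm, h'⟩ := hx ε hε
    exact ⟨m + n, by omega, by omega, LPO.concat h' h⟩

theorem LongSucc.step {X : Type*} [MetricSpace X] [CompactSpace X] {f : X → X}
    (hf : Continuous f) {x y : X} (h : LongSucc f x y) : ∃ z, f z = y ∧ LongSucc f x z := by
  have key : ∀ k : ℕ, ∃ z, dist (f z) y < 1 / ((k : ℝ) + 1) ∧
      ∃ n, k + 1 ≤ n ∧ LPO f (1 / ((k : ℝ) + 1)) n x z := by
    intro k
    obtain ⟨n, hn, -, u, u0, un, hu⟩ := h (1 / ((k : ℝ) + 1)) (by positivity) (k + 2)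
    obtain ⟨m, rfl⟩ : ∃ m, n = m + 1 := ⟨n - 1, by omega⟩
    refine ⟨u m, ?_, m, by omega, u, u0, rfl, fun i hi => hu i (by omega)⟩
    rw [← un]
    exact hu m (by omega)
  choose w hw n hn hl using key
  obtain ⟨z, -, φ, hφ, hz⟩ := isCompact_univ.tendsto_subseq (fun k => mem_univ (w k))
  have h0 : Tendsto (fun k : ℕ => 1 / ((k : ℝ) + 1)) atTop (𝓝 0) :=
    tendsto_one_div_add_atTop_nhds_zero_nat
  refine ⟨z, ?_, ?_⟩
  · have h1 : Tendsto (fun k => f (w k)) atTop (𝓝 y) := by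
      rw [tendsto_iff_dist_tendsto_zero]
      exact squeeze_zero (fun _ => dist_nonneg) (fun k => (hw k).le) h0
    exact tendsto_nhds_unique ((hf.tendsto z).comp hz) (h1.comp hφ.tendsto_atTop)
  · intro ε hε N
    have e1 : ∀ᶠ k in atTop, 1 / (((φ k : ℕ) : ℝ) + 1) < ε / 2 :=
      (h0.comp hφ.tendsto_atTop).eventually (gt_mem_nhds (by positivity))
    have e2 : ∀ᶠ k in atTop, dist (w (φ k)) z < ε / 2 :=
      hz.eventually (Metric.ball_mem_nhds z (by positivity))
    obtain ⟨k, ⟨hk1, hk2⟩, hk3⟩ := ((e1.and e2).and (eventually_ge_atTop N)).exists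
    have := hφ.id_le k
    have hnk := hn (φ k)
    simp only [id] at this
    obtain ⟨u, u0, un, hu⟩ := hl (φ k)
    refine ⟨n (φ k), by omega, by omega, Function.update u (n (φ k)) z, ?_, by simp, ?_⟩
    · rw [Function.update_of_ne (by omega), u0]
    · intro i hi
      rw [Function.update_of_ne (by omega)]
      have hui := hu i hi
      by_cases hi' : i + 1 = n (φ k)
      · rw [hi', Function.update_self]
        rw [hi', un] at hui
        have := dist_triangle (f (u i)) (w (φ k)) z
        linarith
      · rw [Function.update_of_ne hi']
        linarith

/-- For `x, y` in the chain recurrent set, `x ≻ y` iff `y ∈ A_x := ⋂_{ε>0} ⋂_n f^n(U_{x,ε})`. -/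
theorem chainSucc_iff_mem_quasiAttractor {X : Type*} [MetricSpace X] [CompactSpace X]
    (f : X → X) (hf : Continuous f) (x y : X)
    (hx : x ∈ chainRecurrentSet f) (hy : y ∈ chainRecurrentSet f) :
    ChainSucc f x y ↔ y ∈ quasiAttractorOf f x := by
  constructor
  · intro h
    simp only [quasiAttractorOf, Aeps, attractingSetOf, mem_iInter]
    intro ε hε n
    have key : ∃ z, f^[n] z = y ∧ LongSucc f x z := by
      induction n with
      | zero => exact ⟨y, rfl, longSucc_of hx h⟩
      | succ n ih =>
        obtain ⟨z, hz, hl⟩ := ih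
        obtain ⟨w, hw, hl'⟩ := hl.step hf
        exact ⟨w, by rw [Function.iterate_succ_apply, hw, hz], hl'⟩
    obtain ⟨z, hz, hl⟩ := key
    obtain ⟨m, -, hm, hu⟩ := hl ε hε 0
    exact ⟨z, ⟨m, hm, hu⟩, hz⟩
  · intro h ε hε
    simp only [quasiAttractorOf, Aeps, attractingSetOf, mem_iInter] at h
    obtain ⟨z, hz, hzy⟩ := h ε hε 0
    have : z = y := hzy
    exact this ▸ hz

end ChainRecurrence
end

section
/- Let X be a compact metric space and f : X → X a continuous map. For every x in the chain recurrent set R(f), the chain recurrence class of x satisfies [x] = A_x \ ⋃ B(A), where the union is taken over all attracting sets A of f (with some trapping region U) such that x ∉ A, and B(A) := ⋃_{n≥0} f^{-n}(U) denotes the basin of A. -/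
open Set Filter Topology

section ChainRecurrence

variable {X : Type*} [MetricSpace X]

theorem pseudoOrbit_iff (f : X → X) (ε : ℝ) (x y : X) :
    PseudoOrbit f ε x y ↔ Relation.TransGen (fun a b => dist (f a) b < ε) x y := by
  constructor
  · rintro ⟨n, hn, u, rfl, rfl, h⟩
    induction n, hn using Nat.le_induction with
    | base => exact Relation.TransGen.single (h 0 (by omega))
    | succ n hn ih =>
      exact Relation.TransGen.tail (ih fun i hi => h i (by omega)) (h n (by omega))
  · intro h
    induction h with
    | @single b h =>
      refine ⟨1, le_rfl, fun i => if i = 0 then x else b, by simp, by simp, ?_⟩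
      intro i hi
      obtain rfl : i = 0 := by omega
      simpa using h
    | @tail b c _ hbc ih =>
      obtain ⟨n, hn, u, h0, h1, h⟩ := ih
      refine ⟨n + 1, by omega, fun i => if i ≤ n then u i else c, by simpa using h0, by simp, ?_⟩
      intro i hi
      by_cases hin : i = n
      · subst hin
        simpa [h1] using hbc
      · have h2 : i ≤ n := by omega
        have h3 : i + 1 ≤ n := by omega
        simpa [h2, h3] using h i (by omega)

theorem PseudoOrbit.trans' {f : X → X} {ε : ℝ} {x y z : X} (h : PseudoOrbit f ε x y)
    (h' : PseudoOrbit f ε y z) : PseudoOrbit f ε x z := by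
  rw [pseudoOrbit_iff] at *
  exact h.trans h'

theorem PseudoOrbit.perturb {f : X → X} {ε η : ℝ} (hη : 0 < η) {x y z : X}
    (h : PseudoOrbit f ε x y) (h' : dist y z < η) : PseudoOrbit f (ε + η) x z := by
  rw [pseudoOrbit_iff] at *
  obtain ⟨c, hc, hcy⟩ := Relation.TransGen.tail'_iff.1 h
  refine Relation.TransGen.tail' (b := c) (Relation.ReflTransGen.mono (fun a b (hab : dist (f a) b < ε) => (by linarith : dist (f a) b < ε + η)) _ _ hc) ?_
  have := dist_triangle (f c) y z
  show dist (f c) z < ε + η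
  linarith

theorem ChainSucc.trans' {f : X → X} {x y z : X} (h : ChainSucc f x y)
    (h' : ChainSucc f y z) : ChainSucc f x z := fun ε hε => (h ε hε).trans' (h' ε hε)

theorem pseudoOrbit_step (f : X → X) {ε : ℝ} {x y : X} (h : dist (f x) y < ε) :
    PseudoOrbit f ε x y := by
  rw [pseudoOrbit_iff]
  exact Relation.TransGen.single h

theorem trapping_chain [CompactSpace X] {f : X → X} {U : Set X}
    (hU : IsTrappingRegion f U) {y z : X} (hy : y ∈ U) (h : ChainSucc f y z) : z ∈ U := by
  obtain ⟨_, ho, hc⟩ := hU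
  obtain ⟨δ, hδ, hsub⟩ := (isClosed_closure (s := f '' U)).isCompact.exists_thickening_subset_open
    ho hc
  have h1 := (pseudoOrbit_iff _ _ _ _).1 (h δ hδ)
  have key : ∀ a b, a ∈ U → dist (f a) b < δ → b ∈ U := fun a b ha hab =>
    hsub (Metric.mem_thickening_iff.2 ⟨f a, subset_closure (mem_image_of_mem f ha),
      by rwa [dist_comm]⟩)
  clear h
  induction h1 with
  | single h => exact key _ _ hy h
  | tail _ hbc ih => exact key _ _ ih hbc

theorem chain_pred [CompactSpace X] {f : X → X} (hf : Continuous f) {y : X}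
    (h : ChainSucc f y y) : ∃ y', f y' = y ∧ ChainSucc f y y' := by
  have h1 : ∀ k : ℕ, ∃ c, PseudoOrbit f (1 / ((k : ℝ) + 1)) y c ∧
      dist (f c) y < 1 / ((k : ℝ) + 1) := by
    intro k
    have h2 := (pseudoOrbit_iff _ _ _ _).1 (h (1 / ((k : ℝ) + 1)) (by positivity))
    obtain ⟨c, hc, hcy⟩ := Relation.TransGen.tail'_iff.1 h2
    exact ⟨c, (pseudoOrbit_iff _ _ _ _).2 (h2.trans_left hc), hcy⟩
  choose c hc hcy using h1
  obtain ⟨y', φ, hφ, hlim⟩ := CompactSpace.tendsto_subseq c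
  have h0 : Tendsto (fun k => 1 / ((φ k : ℝ) + 1)) atTop (𝓝 0) :=
    (tendsto_one_div_add_atTop_nhds_zero_nat (𝕜 := ℝ)).comp hφ.tendsto_atTop
  refine ⟨y', ?_, ?_⟩
  · refine tendsto_nhds_unique ((hf.tendsto y').comp hlim) ?_
    rw [tendsto_iff_dist_tendsto_zero]
    exact squeeze_zero (fun _ => dist_nonneg) (fun k => (hcy (φ k)).le) h0
  · intro ε hε
    obtain ⟨k, hk1, hk2⟩ := ((h0.eventually (gt_mem_nhds (half_pos hε))).and
      (Metric.tendsto_nhds.1 hlim (ε / 2) (half_pos hε))).exists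
    have := (hc (φ k)).perturb (half_pos hε) hk2
    rw [pseudoOrbit_iff] at *
    exact Relation.TransGen.mono (fun a b (hab : dist (f a) b < _) => (by linarith : dist (f a) b < ε)) _ _ this

theorem mem_attracting [CompactSpace X] {f : X → X} (hf : Continuous f) {U : Set X}
    (hU : IsTrappingRegion f U) {y : X} (hy : y ∈ U) (h : ChainSucc f y y) :
    y ∈ attractingSetOf f U := by
  refine mem_iInter.2 fun n => ?_
  induction n generalizing y with
  | zero => simpa using hy
  | succ n ih =>
    obtain ⟨y', hy', hyy'⟩ := chain_pred hf h
    have h1 : ChainSucc f y' y := fun ε hε => pseudoOrbit_step f (by simpa [hy'] using hε)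
    obtain ⟨w, hw, hwy⟩ := ih (trapping_chain hU hy hyy') (h1.trans' hyy')
    exact ⟨w, hw, by rw [Function.iterate_succ_apply', hwy, hy']⟩

theorem reach_trapping (f : X → X) {ε : ℝ} (hε : 0 < ε) (x : X) :
    IsTrappingRegion f (pseudoReach f ε x) := by
  refine ⟨⟨f x, pseudoOrbit_step f (by simpa using hε)⟩, ?_, ?_⟩
  · rw [isOpen_iff_mem_nhds]
    intro z hz
    obtain ⟨c, hc, hcz⟩ := Relation.TransGen.tail'_iff.1 ((pseudoOrbit_iff _ _ _ _).1 hz)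
    have : {w | dist (f c) w < ε} ∈ 𝓝 z :=
      (isOpen_lt (by fun_prop) (by fun_prop)).mem_nhds hcz
    filter_upwards [this] with w hw
    exact (pseudoOrbit_iff _ _ _ _).2 (Relation.TransGen.tail' hc hw)
  · intro z hz
    obtain ⟨_, ⟨w, hw, rfl⟩, hd⟩ := Metric.mem_closure_iff.1 hz ε hε
    exact PseudoOrbit.trans' hw (pseudoOrbit_step f (by rwa [dist_comm]))

theorem preimage_trapping {f : X → X} (hf : Continuous f) {U : Set X}
    (hU : IsTrappingRegion f U) (n : ℕ) (hne : (f^[n] ⁻¹' U).Nonempty) :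
    IsTrappingRegion f (f^[n] ⁻¹' U) := by
  refine ⟨hne, hU.2.1.preimage (hf.iterate n), ?_⟩
  have h1 : closure (f '' (f^[n] ⁻¹' U)) ⊆ f^[n] ⁻¹' closure (f '' U) := by
    refine closure_minimal ?_ (isClosed_closure.preimage (hf.iterate n))
    rintro _ ⟨w, hw, rfl⟩
    refine subset_closure ⟨f^[n] w, hw, ?_⟩
    exact (Function.iterate_succ_apply' f n w).symm.trans (Function.iterate_succ_apply f n w)
  exact h1.trans (preimage_mono hU.2.2)

/-- For `x ∈ R(f)`, the chain recurrence class satisfies `[x] = A_x \ ⋃ B(A)`, the union being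
over all attracting sets (given by trapping regions `U`) not containing `x`. -/
theorem chainClass_eq_quasiAttractor_diff_basins {X : Type*} [MetricSpace X] [CompactSpace X]
    (f : X → X) (hf : Continuous f) (x : X) (hx : x ∈ chainRecurrentSet f) :
    chainClass f x = quasiAttractorOf f x \
      ⋃ U ∈ {U : Set X | IsTrappingRegion f U ∧ x ∉ attractingSetOf f U}, basinOf f U := by
  ext y
  constructor
  · rintro ⟨hyy, hxy, hyx⟩
    refine ⟨?_, ?_⟩
    · exact mem_iInter₂.2 fun ε hε => mem_attracting hf (reach_trapping f hε x) (hxy ε hε) hyy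
    · intro hy
      obtain ⟨U, ⟨hU, hxU⟩, hyU⟩ := mem_iUnion₂.1 hy
      obtain ⟨n, hn⟩ := mem_iUnion.1 hyU
      have hV := preimage_trapping hf hU n ⟨y, hn⟩
      have hxV := mem_attracting hf hV (trapping_chain hV hn hyx) hx
      obtain ⟨z, hz, hzx⟩ := mem_iInter.1 hxV n
      exact hxU (mem_attracting hf hU (hzx ▸ hz) hx)
  · rintro ⟨hy, hyU⟩
    have hxy : ChainSucc f x y := fun ε hε => by
      obtain ⟨z, hz, hzy⟩ := mem_iInter.1 (mem_iInter₂.1 hy ε hε) 0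
      simp only [Function.iterate_zero, id] at hzy
      exact hzy ▸ hz
    have hyx : ChainSucc f y x := fun ε hε => by
      by_contra hcon
      refine hyU (mem_iUnion₂.2 ⟨pseudoReach f ε y, ⟨reach_trapping f hε y, fun hA => ?_⟩,
        mem_iUnion.2 ⟨1, pseudoOrbit_step f (by simpa using hε)⟩⟩)
      obtain ⟨z, hz, hzx⟩ := mem_iInter.1 hA 0
      simp only [Function.iterate_zero, id] at hzx
      exact hcon (hzx ▸ hz)
    exact ⟨hyx.trans' hxy, hxy, hyx⟩

end ChainRecurrence
end

section
/- Let X be a compact metric space and f : X → X a continuous map. For every x ∈ X, the quasi-attractor A_x := ⋂_{ε>0} A_{x,ε} is nonempty, compact, and satisfies f(A_x) = A_x. -/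
open Set Filter Topology

section ChainRecurrence

variable {X : Type*} [MetricSpace X]

theorem qa_closure (f : X → X) (ε : ℝ) (hε : 0 < ε) (x : X) :
    closure (f '' pseudoReach f ε x) ⊆ pseudoReach f ε x := by
  intro y hy
  obtain ⟨w, ⟨z, hz, rfl⟩, hd⟩ := Metric.mem_closure_iff.1 hy ε hε
  obtain ⟨n, hn, u, h0, h1, hu⟩ := hz
  refine ⟨n + 1, by omega, fun i => if i ≤ n then u i else y, by simp [h0], by simp, ?_⟩
  intro i hi
  by_cases h : i < n
  · have h2 : i ≤ n := h.le
    have h3 : i + 1 ≤ n := h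
    simp only [h2, h3, if_true]
    exact hu i h
  · have h2 : i = n := by omega
    subst h2
    simp [h1, dist_comm]
    simpa [dist_comm] using hd

theorem qa_mono (f : X → X) {ε δ : ℝ} (h : ε ≤ δ) (x : X) :
    pseudoReach f ε x ⊆ pseudoReach f δ x := by
  rintro y ⟨n, hn, u, h0, h1, hu⟩
  exact ⟨n, hn, u, h0, h1, fun i hi => (hu i hi).trans_le h⟩

theorem qa_nonempty (f : X → X) {ε : ℝ} (h : 0 < ε) (x : X) :
    (pseudoReach f ε x).Nonempty := by
  refine ⟨f x, 1, le_rfl, fun i => if i = 0 then x else f x, by simp, by simp, ?_⟩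
  intro i hi
  have : i = 0 := by omega
  subst this
  simpa using h

theorem qa_iter (f : X → X) (K : Set X) (h : f '' K ⊆ K) (n : ℕ) : f^[n] '' K ⊆ K := by
  rw [image_subset_iff]
  exact MapsTo.iterate (f := f) (s := K) (fun z hz => h ⟨z, hz, rfl⟩) n

/-- The quasi-attractor `A_x = ⋂_{ε>0} A_{x,ε}` is nonempty, compact and invariant. -/
theorem quasiAttractor_nonempty_compact_invariant {X : Type*} [MetricSpace X] [CompactSpace X]
    (f : X → X) (hf : Continuous f) (x : X) :
    (quasiAttractorOf f x).Nonempty ∧ IsCompact (quasiAttractorOf f x) ∧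
    f '' quasiAttractorOf f x = quasiAttractorOf f x := by
  have he : ∀ n : ℕ, (0 : ℝ) < 1 / ((n : ℝ) + 1) := fun n => Nat.one_div_pos_of_nat
  obtain ⟨U, hU⟩ : ∃ U : ℕ → Set X, U = fun n : ℕ => pseudoReach f (1 / ((n : ℝ) + 1)) x :=
    ⟨_, rfl⟩
  obtain ⟨K, hK⟩ : ∃ K : ℕ → Set X, K = fun n : ℕ => closure (f '' U n) := ⟨_, rfl⟩
  obtain ⟨C, hC⟩ : ∃ C : ℕ → Set X, C = fun n : ℕ => f^[n] '' K n := ⟨_, rfl⟩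
  have hKU : ∀ n, K n ⊆ U n := by
    intro n; rw [hK, hU]; exact qa_closure f _ (he n) x
  have hUanti : ∀ n, U (n + 1) ⊆ U n := by
    intro n; rw [hU]
    exact qa_mono f (Nat.one_div_le_one_div (Nat.le_succ n)) x
  have hfUK : ∀ n, f '' U n ⊆ K n := by
    intro n; rw [hK]; exact subset_closure
  have hfK : ∀ n, f '' K n ⊆ K n := fun n => (image_mono (hKU n)).trans (hfUK n)
  have hKanti : ∀ n, K (n + 1) ⊆ K n := by
    intro n; rw [hK]; exact closure_mono (image_mono (hUanti n))
  have hCcpt : ∀ n, IsCompact (C n) := by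
    intro n; rw [hC]
    refine IsCompact.image ?_ (hf.iterate n)
    rw [hK]; exact isClosed_closure.isCompact
  have hCne : ∀ n, (C n).Nonempty := by
    intro n; rw [hC, hK, hU]
    exact (((qa_nonempty f (he n) x).image f).closure).image _
  have hCanti : ∀ n, C (n + 1) ⊆ C n := by
    intro n; rw [hC]
    simp only [Function.iterate_succ, image_comp]
    exact image_mono ((hfK _).trans (hKanti n))
  have hfC : ∀ n, f '' C n ⊆ C n := by
    intro n; rw [hC]
    simp only
    rw [← image_comp, ← Function.iterate_succ', Function.iterate_succ, image_comp]
    exact image_mono (hfK n)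
  have hCf : ∀ n, C (n + 1) ⊆ f '' C n := by
    intro n; rw [hC]
    simp only
    rw [Function.iterate_succ', image_comp]
    exact image_mono (image_mono (hKanti n))
  have hA : quasiAttractorOf f x = ⋂ n, C n := by
    apply Subset.antisymm
    · intro y hy
      refine mem_iInter.2 fun n => ?_
      have h1 : y ∈ f^[n + 1] '' U n := by
        rw [hU]
        exact mem_iInter.1 (mem_iInter₂.1 hy _ (he n)) (n + 1)
      rw [Function.iterate_succ, image_comp] at h1
      rw [hC]
      exact image_mono (hfUK n) h1
    · intro y hy
      refine mem_iInter₂.2 fun ε hε => mem_iInter.2 fun m => ?_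
      obtain ⟨N, hN⟩ := exists_nat_one_div_lt hε
      have h1 : y ∈ C (m + N) := mem_iInter.1 hy _
      rw [hC] at h1
      simp only at h1
      rw [Function.iterate_add, image_comp] at h1
      refine image_mono ?_ h1
      refine (qa_iter f _ (hfK _) N).trans ((hKU _).trans ?_)
      rw [hU]
      exact qa_mono f ((Nat.one_div_le_one_div (Nat.le_add_left N m)).trans hN.le) x
  rw [hA]
  refine ⟨?_, ?_, ?_⟩
  · exact IsCompact.nonempty_iInter_of_sequence_nonempty_isCompact_isClosed C hCanti hCne
      (hCcpt 0) (fun n => (hCcpt n).isClosed)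
  · exact (isClosed_iInter fun n => (hCcpt n).isClosed).isCompact
  · apply Subset.antisymm
    · rintro _ ⟨z, hz, rfl⟩
      exact mem_iInter.2 fun n => hfC n ⟨z, mem_iInter.1 hz n, rfl⟩
    · intro y hy
      have hcl : IsClosed (f ⁻¹' {y}) := isClosed_singleton.preimage hf
      obtain ⟨z, hz⟩ := IsCompact.nonempty_iInter_of_sequence_nonempty_isCompact_isClosed
        (fun n => C n ∩ f ⁻¹' {y}) (fun n => inter_subset_inter_left _ (hCanti n))
        (fun n => by
          obtain ⟨z, hz, hzy⟩ := hCf n (mem_iInter.1 hy (n + 1))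
          exact ⟨z, hz, hzy⟩)
        ((hCcpt 0).inter_right hcl) (fun n => (hCcpt n).isClosed.inter hcl)
      exact ⟨z, mem_iInter.2 fun n => (mem_iInter.1 hz n).1, (mem_iInter.1 hz 0).2⟩

end ChainRecurrence
end

section
/- Let X be a compact metric space and f : X → X a continuous map. For every x ∈ X and ε > 0 there exists r > 0 such that for every y ∈ X with dist(y, x) < r, every limit value of the sequence (f^n(y))_{n≥1} belongs to the attracting set A_{x,ε}. -/
open Set Filter Topology

section ChainRecurrence

variable {X : Type*} [MetricSpace X]

/-- For every `x` and `ε > 0` there is `r > 0` such that every limit value of the sequence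
`(f^n y)_{n ≥ 1}`, for `y` with `dist y x < r`, belongs to `A_{x,ε}`. -/
theorem limit_values_mem_Aeps {X : Type*} [MetricSpace X] [CompactSpace X]
    (f : X → X) (hf : Continuous f) (x : X) (ε : ℝ) (hε : 0 < ε) :
    ∃ r : ℝ, 0 < r ∧ ∀ y : X, dist y x < r → ∀ p : X,
      (∃ φ : ℕ → ℕ, StrictMono φ ∧ (∀ k, 1 ≤ φ k) ∧
        Tendsto (fun k => f^[φ k] y) atTop (𝓝 p)) → p ∈ Aeps f ε x := by
  obtain ⟨r, hr, h⟩ := Metric.continuous_iff.1 hf x ε hε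
  refine ⟨r, hr, ?_⟩
  rintro y hy p ⟨φ, hφ, -, hp⟩
  have hfy := h y hy
  refine mem_iInter.2 fun n => ?_
  obtain ⟨q, -, ψ, hψ, hq⟩ := (isCompact_univ (X := X)).tendsto_subseq
    (x := fun k => f^[φ (k + n) - n] y) (fun _ => mem_univ _)
  refine ⟨q, ?_, ?_⟩
  · obtain ⟨N, hN⟩ := Metric.tendsto_atTop.1 hq ε hε
    have h1 := hN (N + 2) (by omega)
    have h2 := hψ.id_le (N + 2)
    have h3 := hφ.id_le (ψ (N + 2) + n)
    simp only [Function.comp, id] at h1 h2 h3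
    obtain ⟨m, hm⟩ : ∃ m, m = φ (ψ (N + 2) + n) - n := ⟨_, rfl⟩
    rw [← hm] at h1
    have hm2 : 2 ≤ m := by omega
    refine ⟨m, by omega, fun i => if i = 0 then x else if i < m then f^[i] y else q, by simp,
      ?_, ?_⟩
    · have : m ≠ 0 := by omega
      simp [this]
    · intro i hi
      rcases Nat.eq_zero_or_pos i with rfl | h0
      · have : 1 < m := by omega
        simpa [this, dist_comm] using hfy
      · have h0' : i ≠ 0 := by omega
        by_cases hlt : i + 1 < m
        · simp [h0', hi, hlt, ← Function.iterate_succ_apply' f, hε]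
        · have : i + 1 = m := by omega
          simp only [h0', hi, hlt, if_true, if_false, Nat.succ_ne_zero,
            ← Function.iterate_succ_apply' f, Nat.succ_eq_add_one]
          rw [this]; exact h1
  · have e1 := ((hf.iterate n).tendsto q).comp hq
    have t : Tendsto (fun k => ψ k + n) atTop atTop :=
      tendsto_atTop_mono (fun k => Nat.le_add_right _ _) hψ.tendsto_atTop
    have e2 := hp.comp t
    refine tendsto_nhds_unique e1 (e2.congr fun k => ?_)
    have h3 := hφ.id_le (ψ k + n)
    simp only [Function.comp, id] at h3 ⊢
    rw [← Function.iterate_add_apply]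
    congr 2
    omega

end ChainRecurrence
end

section
/- Let X be a compact metric space, f : X → X a continuous map, x ∈ X, and C ⊆ X a nonempty compact set. If for every ε > 0 there exists an ε-pseudo-orbit starting at x that contains a point of C, then there exists y ∈ C with x ≻ y. -/
open Set Filter Topology

section ChainRecurrence

variable {X : Type*} [MetricSpace X]

/-- If for every `ε > 0` there is an `ε`-pseudo-orbit starting at `x` that passes through a
point of the nonempty compact set `C`, then `x ≻ y` for some `y ∈ C`. -/
theorem chainSucc_to_compact {X : Type*} [MetricSpace X] [CompactSpace X]
    (f : X → X) (hf : Continuous f) (x : X) (C : Set X)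
    (hC : IsCompact C) (hCne : C.Nonempty)
    (h : ∀ ε : ℝ, 0 < ε → ∃ n : ℕ, 1 ≤ n ∧ ∃ u : ℕ → X, u 0 = x ∧
      (∀ i, i < n → dist (f (u i)) (u (i + 1)) < ε) ∧ ∃ i, 1 ≤ i ∧ i ≤ n ∧ u i ∈ C) :
    ∃ y ∈ C, ChainSucc f x y := by
  have key : ∀ k : ℕ, ∃ y ∈ C, PseudoOrbit f (1 / ((k : ℝ) + 1)) x y := by
    intro k
    obtain ⟨n, _, u, hu0, hu, i, hi1, hin, hiC⟩ := h (1 / ((k : ℝ) + 1)) (by positivity)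
    exact ⟨u i, hiC, i, hi1, u, hu0, rfl, fun j hj => hu j (by omega)⟩
  choose y hyC hy using key
  obtain ⟨z, hzC, φ, hφ, hlim⟩ := hC.tendsto_subseq hyC
  refine ⟨z, hzC, fun ε hε => ?_⟩
  have h1 : ∀ᶠ k in atTop, dist (y (φ k)) z < ε / 2 :=
    (Metric.tendsto_nhds.1 hlim) (ε / 2) (by positivity)
  have h2 : ∀ᶠ k in atTop, 1 / ((φ k : ℝ) + 1) < ε / 2 :=
    (tendsto_one_div_add_atTop_nhds_zero_nat.comp hφ.tendsto_atTop).eventually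
      (gt_mem_nhds (by positivity))
  obtain ⟨k, hk1, hk2⟩ := (h1.and h2).exists
  obtain ⟨n, hn, u, hu0, hun, hu⟩ := hy (φ k)
  refine ⟨n, hn, Function.update u n z, ?_, by simp, fun i hi => ?_⟩
  · rw [Function.update_of_ne (by omega), hu0]
  · rw [Function.update_of_ne (by omega)]
    have h3 := hu i hi
    by_cases hin : i + 1 = n
    · rw [hin, hun] at h3
      rw [hin, Function.update_self]
      linarith [dist_triangle (f (u i)) (y (φ k)) z]
    · rw [Function.update_of_ne hin]
      linarith

end ChainRecurrence
end

section
/- Let X be a compact metric space, f : X → X a continuous map, and A ⊆ X an attracting set of f. If C ⊆ A is a nonempty subset which is both open and closed in the subspace topology of A and satisfies f(C) = C, then C is an attracting set of f, i.e., there exists a trapping region V ⊆ X with C = ⋂_{n≥0} f^n(V). -/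
open Set Filter Topology

section ChainRecurrence

variable {X : Type*} [MetricSpace X]

theorem aux_shrink {X : Type*} [MetricSpace X] [CompactSpace X]
    (f : X → X) (hf : Continuous f) (C P : Set X) (hP : IsOpen P) (hfC : f '' C = C) (n : ℕ) :
    ∀ W : Set X, IsOpen W → C ⊆ W → f '' closure W ⊆ W → f^[n] '' closure W ⊆ P →
      ∃ Q : Set X, IsOpen Q ∧ C ⊆ Q ∧ f '' closure Q ⊆ Q ∧ Q ⊆ W ∧ Q ⊆ P := by
  induction n with
  | zero =>
    intro W hW hCW hfW hn
    refine ⟨W, hW, hCW, hfW, Subset.rfl, ?_⟩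
    simp only [Function.iterate_zero, image_id] at hn
    exact subset_closure.trans hn
  | succ n ih =>
    intro W hW hCW hfW hn
    have hcl : IsClosed (f '' closure W) := (isClosed_closure.isCompact.image hf).isClosed
    have hop : IsOpen (W ∩ f^[n] ⁻¹' P) := hW.inter (hP.preimage (hf.iterate n))
    have hsub : f '' closure W ⊆ W ∩ f^[n] ⁻¹' P := by
      refine subset_inter hfW ?_
      rintro _ ⟨x, hx, rfl⟩
      exact hn ⟨x, hx, rfl⟩
    obtain ⟨Q, hQ, h1, h2⟩ := normal_exists_closure_subset hcl hop hsub
    have hQW : closure Q ⊆ W := h2.trans inter_subset_left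
    obtain ⟨R, a, b, c, d, e⟩ := ih Q hQ
      (by
        rw [← hfC]
        exact (image_mono (hCW.trans subset_closure)).trans h1)
      ((image_mono (hQW.trans subset_closure)).trans h1)
      (image_subset_iff.2 (h2.trans inter_subset_right))
    exact ⟨R, a, b, c, d.trans (subset_closure.trans hQW), e⟩

/-- A nonempty invariant subset of an attracting set which is clopen in the subspace topology
of the attracting set is itself an attracting set. -/
theorem clopen_invariant_subset_isAttractingSet {X : Type*} [MetricSpace X] [CompactSpace X]
    (f : X → X) (hf : Continuous f) (A C : Set X)
    (hA : IsAttractingSet f A) (hCA : C ⊆ A) (hCne : C.Nonempty)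
    (hclopen : IsClopen (Subtype.val ⁻¹' C : Set A)) (hfC : f '' C = C) :
    IsAttractingSet f C := by
  obtain ⟨U, ⟨-, hUo, hUt⟩, rfl⟩ := hA
  have hcU : f '' closure U ⊆ U := (image_closure_subset_closure_image hf).trans hUt
  have hstep : ∀ n, f^[n+1] '' closure U ⊆ f^[n] '' U := by
    intro n
    rw [Function.iterate_succ, image_comp]
    exact image_mono hcU
  have hK : attractingSetOf f U = ⋂ n : ℕ, f^[n] '' closure U := by
    apply Subset.antisymm
    · exact iInter_mono fun n => image_mono subset_closure
    · exact subset_iInter fun n => (iInter_subset _ (n+1)).trans (hstep n)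
  have hKc : ∀ n, IsCompact (f^[n] '' closure U) := fun n =>
    isClosed_closure.isCompact.image (hf.iterate n)
  have hAcl : IsClosed (attractingSetOf f U) := by
    rw [hK]
    exact isClosed_iInter fun n => (hKc n).isClosed
  have hanti : Antitone fun n : ℕ => f^[n] '' closure U :=
    antitone_nat_of_succ_le fun n => (hstep n).trans (image_mono subset_closure)
  have hCcl : IsClosed C := by
    have := hAcl.isClosedEmbedding_subtypeVal.isClosedMap _ hclopen.1
    rwa [Subtype.image_preimage_coe, inter_eq_right.2 hCA] at this
  have hDcl : IsClosed (attractingSetOf f U \ C) := by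
    have := hAcl.isClosedEmbedding_subtypeVal.isClosedMap _ hclopen.compl.1
    rwa [← preimage_compl, Subtype.image_preimage_coe, ← sdiff_eq] at this
  obtain ⟨O, O', hO, hO', hCO, hDO, hdis⟩ :=
    normal_separation hCcl hDcl disjoint_sdiff_right
  have hO1 : IsOpen (O ∩ f ⁻¹' O) := hO.inter (hO.preimage hf)
  have hCO1 : C ⊆ O ∩ f ⁻¹' O := by
    refine subset_inter hCO (image_subset_iff.1 ?_)
    rwa [hfC]
  have hP : IsOpen ((O ∩ f ⁻¹' O) ∪ O') := hO1.union hO'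
  have hAP : attractingSetOf f U ⊆ (O ∩ f ⁻¹' O) ∪ O' := by
    intro x hx
    by_cases h : x ∈ C
    · exact Or.inl (hCO1 h)
    · exact Or.inr (hDO ⟨hx, h⟩)
  obtain ⟨n, hn⟩ := exists_subset_nhds_of_isCompact hanti.directed_ge hKc
    (U := (O ∩ f ⁻¹' O) ∪ O') (fun x hx => hP.mem_nhds (hAP (hK ▸ hx)))
  have hCU : C ⊆ U := hCA.trans ((iInter_subset _ 0).trans (by simp))
  obtain ⟨W, hW, hCW, hfW, hWU, hWP⟩ := aux_shrink f hf C _ hP hfC n U hUo hCU hcU hn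
  refine ⟨W ∩ (O ∩ f ⁻¹' O), ⟨?_, hW.inter hO1, ?_⟩, ?_⟩
  · exact hCne.mono (subset_inter hCW hCO1)
  · intro y hy
    have hyW : y ∈ W := by
      apply hfW
      rw [← (isClosed_closure.isCompact.image hf).isClosed.closure_eq]
      exact closure_mono (image_mono (inter_subset_left.trans subset_closure)) hy
    have hyO : y ∈ closure O := by
      refine closure_mono ?_ hy
      rintro _ ⟨x, hx, rfl⟩
      exact hx.2.2
    refine ⟨hyW, (hWP hyW).resolve_right fun h => ?_⟩
    exact (hdis.closure_left hO').le_bot ⟨hyO, h⟩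
  · apply Subset.antisymm
    · refine subset_iInter fun n => ?_
      have : f^[n] '' C = C := by
        induction n with
        | zero => simp
        | succ n ih => rw [Function.iterate_succ, image_comp, hfC, ih]
      rw [← this]
      exact image_mono (subset_inter hCW hCO1)
    · intro y hy
      have hyA : y ∈ attractingSetOf f U :=
        iInter_mono (fun n => image_mono (inter_subset_left.trans hWU)) hy
      have hy0 : y ∈ W ∩ (O ∩ f ⁻¹' O) := by simpa using mem_iInter.1 hy 0
      by_contra h
      exact hdis.le_bot ⟨hy0.2.1, hDO ⟨hyA, h⟩⟩

end ChainRecurrence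
end
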